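/- Let q be a polynomial of degree N ≥ 1 with nonnegative coefficients and q(0) = 0, whose equation q(z) = q(1) has N distinct complex roots b_1, …, b_N with b_1 = 1 and |b_j| > 1 for all j ≥ 2, and let φ_n be the n-th Taylor coefficient at 0 of Φ(z) := z·∏_{j=1}^N (1 − z/b_j)^{−1 − q(1)/(q'(b_j) b_j)} (principal branches). Set β := q(1)/q'(1), C := (1/Γ(1 + β))·∏_{j=2}^N (1 − 1/b_j)^{−1 − q(1)/(q'(b_j) b_j)}, and D := q(1)(q'(1) − q(1))(q''(1) + q'(1)) / (2 q'(1)^3). Then φ_n = C·n^β + C·D·n^{β−1} + o(n^{β−1}) as n → ∞. -/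

import Mathlib

open Polynomial Filter Asymptotics

/-- The closed-form solution `Φ(z) = z·∏_j (1 − z/b_j)^(−1 − q(1)/(q'(b_j)b_j))`
(principal-branch complex powers) of Corollary 1. -/
noncomputable def PhiProd (N : ℕ) (q : Polynomial ℝ) (b : Fin N → ℂ) : ℂ → ℂ :=
  fun z => z * ∏ j, (1 - z / b j) ^
    (-1 - ((q.eval 1 : ℝ) : ℂ) / (Polynomial.aeval (b j) q.derivative * b j))

open scoped Topology

/-- Stolz–Cesàro theorem in the `0/0` case. -/
theorem tendsto_div_of_tendsto_sub_div_sub {u v : ℕ → ℝ} {l : ℝ} (hu : Tendsto u atTop (𝓝 0))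
    (hv : Tendsto v atTop (𝓝 0)) (hanti : ∀ᶠ n in atTop, v (n + 1) < v n)
    (h : Tendsto (fun n => (u n - u (n + 1)) / (v n - v (n + 1))) atTop (𝓝 l)) :
    Tendsto (fun n => u n / v n) atTop (𝓝 l) := by
  have key : ∀ {w : ℕ → ℝ} {m : ℕ}, Tendsto w atTop (𝓝 0) → (∀ n ≥ m, w (n + 1) ≤ w n) →
      ∀ n ≥ m, 0 ≤ w n := by
    intro w m hw hmono n hn
    have := (antitone_add_nat_of_succ_le fun k hk => hmono k (hn.trans hk)).le_of_tendsto
      (hw.comp (tendsto_add_atTop_nat n)) 0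
    simpa using this
  rw [Metric.tendsto_atTop]
  intro ε hε
  obtain ⟨m, hm⟩ := eventually_atTop.1
    (hanti.and (Metric.tendsto_nhds.1 h (ε / 2) (half_pos hε)))
  have hstep : ∀ n ≥ m, |u n - u (n + 1) - l * (v n - v (n + 1))| ≤
      ε / 2 * (v n - v (n + 1)) := by
    intro n hn
    obtain ⟨hlt, hd⟩ := hm n hn
    have hpos : 0 < v n - v (n + 1) := sub_pos.2 hlt
    have hmul : u n - u (n + 1) - l * (v n - v (n + 1)) =
        ((u n - u (n + 1)) / (v n - v (n + 1)) - l) * (v n - v (n + 1)) := by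
      field_simp
    rw [hmul, abs_mul, abs_of_pos hpos]
    exact mul_le_mul_of_nonneg_right hd.le hpos.le
  have hlow := key (w := fun n => ε / 2 * v n - (u n - l * v n)) (m := m)
    (by simpa using (hv.const_mul (ε / 2)).sub (hu.sub (hv.const_mul l)))
    fun n hn => by linarith [(abs_le.1 (hstep n hn)).2]
  have hupp := key (w := fun n => ε / 2 * v n + (u n - l * v n)) (m := m)
    (by simpa using (hv.const_mul (ε / 2)).add (hu.sub (hv.const_mul l)))
    fun n hn => by linarith [(abs_le.1 (hstep n hn)).1]
  have hvnn := key (m := m) hv fun n hn => (hm n hn).1.le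
  refine ⟨m, fun n hn => ?_⟩
  have hvpos : 0 < v n := (hvnn (n + 1) (by omega)).trans_lt (hm n hn).1
  have hdiv : u n / v n - l = (u n - l * v n) / v n := by field_simp
  rw [Real.dist_eq, hdiv, abs_div, abs_of_pos hvpos, div_lt_iff₀ hvpos]
  refine lt_of_le_of_lt (abs_le.2 ⟨?_, ?_⟩) (mul_lt_mul_of_pos_right (half_lt_self hε) hvpos)
  · linarith [hupp n hn]
  · linarith [hlow n hn]

/-- The coefficient `a (a + 1) ⋯ (a + n - 1) / n!` of `z ^ n` in `(1 - z) ^ (-a)`. -/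
noncomputable def risingCoeff (a : ℝ) (n : ℕ) : ℝ :=
  (∏ k ∈ Finset.range n, (a + k)) / n.factorial

theorem risingCoeff_succ (a : ℝ) (n : ℕ) :
    risingCoeff a (n + 1) = risingCoeff a n * ((a + n) / (n + 1)) := by
  rw [risingCoeff, risingCoeff, Finset.prod_range_succ, Nat.factorial_succ]
  push_cast
  rw [div_mul_div_comm, mul_comm ((n : ℝ) + 1)]

theorem risingCoeff_add_one (a : ℝ) (n : ℕ) :
    a * risingCoeff (a + 1) n = (a + n) * risingCoeff a n := by
  have h : a * ∏ k ∈ Finset.range n, (a + 1 + k) = (a + n) * ∏ k ∈ Finset.range n, (a + k) := by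
    rw [mul_comm (a + n), ← Finset.prod_range_succ, Finset.prod_range_succ', mul_comm]
    simp only [Nat.cast_add, Nat.cast_one, Nat.cast_zero, add_zero]
    simp only [add_assoc, add_comm (1 : ℝ)]
  rw [risingCoeff, risingCoeff, ← mul_div_assoc, h, mul_div_assoc]

theorem iteratedDeriv_one_sub_cpow_neg (a : ℝ) (n : ℕ) :
    iteratedDeriv n (fun z : ℂ => (1 - z) ^ (-(a : ℂ))) 0 / (n.factorial : ℂ) =
      (risingCoeff a n : ℂ) := by
  have h1 := (Complex.one_div_one_sub_cpow_hasFPowerSeriesOnBall_zero (a : ℂ)).hasFPowerSeriesAt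
  have h2 := h1.analyticAt.hasFPowerSeriesAt
  have h3 := congrArg (fun p => FormalMultilinearSeries.coeff p n)
    (h2.eq_formalMultilinearSeries h1)
  simp only [FormalMultilinearSeries.coeff_ofScalars, one_div, ← Complex.cpow_neg] at h3
  rw [h3, ← Ring.multichoose_eq, risingCoeff]
  have h4 := Ring.factorial_nsmul_multichoose_eq_ascPochhammer (a : ℂ) n
  have h5 : ∀ n, (ascPochhammer ℕ n).smeval (a : ℂ) = ∏ k ∈ Finset.range n, ((a : ℂ) + k) := by
    intro n
    induction n with
    | zero => simp
    | succ n ih =>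
      rw [ascPochhammer_succ_right, Polynomial.smeval_mul, ih, Finset.prod_range_succ]
      simp [Polynomial.smeval_natCast]
  rw [h5, nsmul_eq_mul] at h4
  push_cast
  rw [← h4, mul_div_cancel_left₀ _ (by exact_mod_cast n.factorial_ne_zero)]

theorem analyticAt_one_sub_cpow (a : ℂ) : AnalyticAt ℂ (fun z : ℂ => (1 - z) ^ a) 0 := by
  exact AnalyticAt.cpow (by fun_prop) (by fun_prop) (by simp)

theorem tendsto_risingCoeff {β : ℝ} (hβ : 0 < β) :
    Tendsto (fun n : ℕ => risingCoeff (1 + β) n / (n : ℝ) ^ β) atTop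
      (𝓝 (Real.Gamma (1 + β))⁻¹) := by
  have h := ((Real.GammaSeq_tendsto_Gamma β).const_mul β).inv₀
    (mul_ne_zero hβ.ne' (Real.Gamma_pos_of_pos hβ).ne')
  rw [← Real.Gamma_add_one hβ.ne', add_comm β] at h
  refine h.congr' ?_
  filter_upwards [eventually_gt_atTop 0] with n hn
  have h1 := risingCoeff_add_one β n
  have h2 : risingCoeff β n * n.factorial = ∏ k ∈ Finset.range n, (β + k) :=
    div_mul_cancel₀ _ (by positivity)
  have h3 : (0 : ℝ) < (n : ℝ) ^ β := by positivity
  rw [Real.GammaSeq, Finset.prod_range_succ, ← h2, mul_comm _ (β + (n : ℝ)), ← mul_assoc, ← h1,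
    add_comm 1 β]
  field_simp

theorem tendsto_one_add_mul_one_sub_rpow (β : ℝ) :
    Tendsto (fun x : ℝ => (1 - (1 + β * x) * (1 - x) ^ β) / x ^ 2) (𝓝[>] 0)
      (𝓝 (β * (β + 1) / 2)) := by
  have hev : ∀ᶠ x : ℝ in 𝓝[>] 0, 0 < x ∧ x < 1 := by
    filter_upwards [Ioo_mem_nhdsGT (zero_lt_one' ℝ)] with x hx using hx
  have hcont : Tendsto (fun x : ℝ => (1 - x) ^ (β - 1)) (𝓝[>] 0) (𝓝 1) := by
    have : ContinuousAt (fun x : ℝ => (1 - x) ^ (β - 1)) 0 :=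
      ContinuousAt.rpow_const (by fun_prop) (by simp)
    simpa using this.tendsto.mono_left nhdsWithin_le_nhds
  refine HasDerivAt.lhopital_zero_nhdsGT (f' := fun x => β * (β + 1) * x * (1 - x) ^ (β - 1))
    (g' := fun x => 2 * x) ?_ ?_ ?_ ?_ ?_ ?_
  · filter_upwards [hev] with x hx
    have hx1 : 0 < 1 - x := by linarith [hx.2]
    have h1 : HasDerivAt (fun x : ℝ => (1 - x) ^ β) ((-1) * β * (1 - x) ^ (β - 1)) x :=
      ((hasDerivAt_id x).const_sub 1).rpow_const (Or.inl hx1.ne')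
    have h2 : HasDerivAt (fun x : ℝ => 1 + β * x) β x := by
      simpa using ((hasDerivAt_id x).const_mul β).const_add 1
    convert! (h2.mul h1).const_sub 1 using 1
    have h3 : (1 - x) ^ β = (1 - x) ^ (β - 1) * (1 - x) := by
      rw [← Real.rpow_add_one hx1.ne']; ring_nf
    rw [h3]; ring
  · exact Eventually.of_forall fun x => by simpa using hasDerivAt_pow 2 x
  · filter_upwards [hev] with x hx
    linarith [hx.1]
  · have : ContinuousAt (fun x : ℝ => 1 - (1 + β * x) * (1 - x) ^ β) 0 :=
      continuousAt_const.sub (ContinuousAt.mul (by fun_prop)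
        (ContinuousAt.rpow_const (by fun_prop) (by simp)))
    simpa using this.tendsto.mono_left nhdsWithin_le_nhds
  · have : ContinuousAt (fun x : ℝ => x ^ 2) 0 := by fun_prop
    simpa using this.tendsto.mono_left nhdsWithin_le_nhds
  · have := hcont.const_mul (β * (β + 1) / 2)
    rw [mul_one] at this
    refine this.congr' ?_
    filter_upwards [hev] with x hx
    have := hx.1.ne'
    field_simp

theorem tendsto_risingCoeff_second_order {β : ℝ} (hβ : 0 < β) :
    Tendsto (fun n : ℕ => n * (risingCoeff (1 + β) n / (n : ℝ) ^ β - (Real.Gamma (1 + β))⁻¹)) atTop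
      (𝓝 ((Real.Gamma (1 + β))⁻¹ * (β * (β + 1) / 2))) := by
  have h0 := tendsto_risingCoeff hβ
  set L := (Real.Gamma (1 + β))⁻¹
  set r : ℕ → ℝ := fun n => risingCoeff (1 + β) n / (n : ℝ) ^ β with hr
  have hinv : Tendsto (fun n : ℕ => ((n : ℝ) + 1)⁻¹) atTop (𝓝[>] 0) := by
    refine tendsto_nhdsWithin_iff.2 ⟨?_, Eventually.of_forall fun n => ?_⟩
    · simpa using tendsto_one_div_add_atTop_nhds_zero_nat (𝕜 := ℝ)
    · exact Set.mem_Ioi.2 (by positivity)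
  have hratio : Tendsto (fun n : ℕ => (n : ℝ) / (n + 1)) atTop (𝓝 1) :=
    tendsto_natCast_div_add_atTop 1
  have main := tendsto_div_of_tendsto_sub_div_sub (u := fun n => r n - L)
    (v := fun n : ℕ => (n : ℝ)⁻¹) (l := L * (β * (β + 1) / 2)) (by simpa using h0.sub_const L)
    tendsto_inv_atTop_nhds_zero_nat ?_ ?_
  · refine main.congr fun n => ?_
    rw [div_inv_eq_mul, mul_comm]
  · filter_upwards [eventually_gt_atTop 0] with n hn
    have hn' : (0 : ℝ) < n := by exact_mod_cast hn
    push_cast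
    gcongr
    linarith
  · have := (h0.mul ((tendsto_one_add_mul_one_sub_rpow β).comp hinv)).mul hratio
    rw [mul_one] at this
    refine this.congr' ?_
    filter_upwards [eventually_gt_atTop 0] with n hn
    have hn' : (0 : ℝ) < n := by exact_mod_cast hn
    have hx : 1 - ((n : ℝ) + 1)⁻¹ = n / (n + 1) := by field_simp; ring
    simp only [Function.comp, hr]
    rw [hx, risingCoeff_succ, Real.div_rpow hn'.le (by positivity)]
    push_cast
    have : (0 : ℝ) < (n : ℝ) ^ β := by positivity
    have : (0 : ℝ) < ((n : ℝ) + 1) ^ β := by positivity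
    field_simp
    ring

theorem tendsto_risingCoeff_lower {β : ℝ} (hβ : 0 < β) :
    Tendsto (fun n : ℕ => ((n : ℝ) + 1) ^ (1 - β) * risingCoeff β n) atTop
      (𝓝 (β * (Real.Gamma (1 + β))⁻¹)) := by
  have h1 : Tendsto (fun n : ℕ => ((n : ℝ) / (n + 1)) ^ (β - 1)) atTop (𝓝 1) := by
    simpa using (tendsto_natCast_div_add_atTop (1 : ℝ)).rpow_const (p := β - 1) (by simp)
  have h2 := ((tendsto_natCast_div_add_atTop β).const_mul β).mul (h1.mul (tendsto_risingCoeff hβ))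
  rw [mul_one, one_mul] at h2
  refine h2.congr' ?_
  filter_upwards [eventually_gt_atTop 0] with n hn
  have hn' : (0 : ℝ) < n := by exact_mod_cast hn
  have h3 : risingCoeff β n = β * risingCoeff (1 + β) n / (β + n) := by
    rw [add_comm 1 β, risingCoeff_add_one]
    field_simp
  have : (0 : ℝ) < (n : ℝ) ^ β := by positivity
  have : (0 : ℝ) < ((n : ℝ) + 1) ^ β := by positivity
  rw [h3, Real.div_rpow hn'.le (by positivity), Real.rpow_sub_one hn'.ne',
    Real.rpow_sub_one (by positivity), Real.rpow_sub (by positivity), Real.rpow_one]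
  field_simp
  ring

/-- If `(n + 1) ^ s * e n` converges and `(n + 1) ^ s * k n` is absolutely summable, then the
convolution of `k` and `e` is asymptotic to `(∑' i, k i) * e n`. -/
theorem tendsto_weighted_convolution {s : ℝ} (hs : 0 ≤ s) {e k : ℕ → ℂ} {L : ℂ}
    (he : Tendsto (fun n : ℕ => ((((n : ℝ) + 1) ^ s : ℝ) : ℂ) * e n) atTop (𝓝 L))
    (hk : Summable fun n : ℕ => ((n : ℝ) + 1) ^ s * ‖k n‖) :
    Tendsto (fun n : ℕ => ((((n : ℝ) + 1) ^ s : ℝ) : ℂ) *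
      ∑ i ∈ Finset.range (n + 1), k i * e (n - i)) atTop (𝓝 ((∑' i, k i) * L)) := by
  obtain ⟨M, hM⟩ := he.norm.bddAbove_range
  have hM' : ∀ n : ℕ, ((n : ℝ) + 1) ^ s * ‖e n‖ ≤ M := by
    intro n
    have : ‖((((n : ℝ) + 1) ^ s : ℝ) : ℂ) * e n‖ ≤ M := hM ⟨n, rfl⟩
    rwa [norm_mul, Complex.norm_real, Real.norm_of_nonneg (by positivity)] at this
  set f : ℕ → ℕ → ℂ := fun n i =>
    if i ≤ n then ((((n : ℝ) + 1) ^ s : ℝ) : ℂ) * (k i * e (n - i)) else 0 with hf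
  have hsum : ∀ n : ℕ, ∑' i, f n i = ((((n : ℝ) + 1) ^ s : ℝ) : ℂ) *
      ∑ i ∈ Finset.range (n + 1), k i * e (n - i) := by
    intro n
    rw [tsum_eq_sum (s := Finset.range (n + 1)), Finset.mul_sum]
    · refine Finset.sum_congr rfl fun i hi => ?_
      simp only [hf, if_pos (Nat.lt_succ_iff.1 (Finset.mem_range.1 hi))]
    · intro i hi
      have : ¬ i ≤ n := fun h => hi (Finset.mem_range.2 (Nat.lt_succ_iff.2 h))
      simp only [hf, if_neg this]
  rw [← tsum_mul_right]
  refine (tendsto_tsum_of_dominated_convergence (f := f)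
    (bound := fun i : ℕ => ((i : ℝ) + 1) ^ s * ‖k i‖ * M) (hk.mul_right M) (fun i => ?_)
    (Eventually.of_forall fun n i => ?_)).congr hsum
  · rw [← tendsto_add_atTop_iff_nat i]
    have h1 : Tendsto (fun n : ℕ => (((n : ℝ) + 1 + i) / ((n : ℝ) + 1)) ^ s) atTop (𝓝 1) := by
      have h2 : Tendsto (fun n : ℕ => 1 + (i : ℝ) * (1 / ((n : ℝ) + 1))) atTop (𝓝 1) := by
        simpa using ((tendsto_one_div_add_atTop_nhds_zero_nat (𝕜 := ℝ)).const_mul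
          (i : ℝ)).const_add 1
      have h3 := h2.rpow_const (p := s) (by simp)
      rw [Real.one_rpow] at h3
      refine h3.congr fun n => ?_
      congr 1
      field_simp
    have h4 := ((Complex.continuous_ofReal.tendsto 1).comp h1).mul (he.const_mul (k i))
    simp only [Complex.ofReal_one, one_mul] at h4
    refine h4.congr fun n => ?_
    have h5 : (0 : ℝ) < ((n : ℝ) + 1) ^ s := by positivity
    have h6 : ((((n : ℝ) + 1) ^ s : ℝ) : ℂ) ≠ 0 := by exact_mod_cast h5.ne'
    simp only [hf, Function.comp, if_pos (Nat.le_add_left i n), Nat.add_sub_cancel]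
    rw [Real.div_rpow (by positivity) (by positivity), Complex.ofReal_div]
    push_cast [add_right_comm]
    field_simp
  · simp only [hf]
    split_ifs with h
    · obtain ⟨m, rfl⟩ := Nat.exists_eq_add_of_le h
      rw [Nat.add_sub_cancel_left, norm_mul, norm_mul, Complex.norm_real,
        Real.norm_of_nonneg (by positivity)]
      have h1 : (((i + m : ℕ) : ℝ) + 1) ^ s ≤ ((i : ℝ) + 1) ^ s * ((m : ℝ) + 1) ^ s := by
        rw [← Real.mul_rpow (by positivity) (by positivity)]
        refine Real.rpow_le_rpow (by positivity) ?_ hs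
        push_cast
        nlinarith [mul_nonneg (Nat.cast_nonneg (α := ℝ) i) (Nat.cast_nonneg (α := ℝ) m)]
      calc (((i + m : ℕ) : ℝ) + 1) ^ s * (‖k i‖ * ‖e m‖)
          ≤ ((i : ℝ) + 1) ^ s * ((m : ℝ) + 1) ^ s * (‖k i‖ * ‖e m‖) := by gcongr
        _ = ((i : ℝ) + 1) ^ s * ‖k i‖ * (((m : ℝ) + 1) ^ s * ‖e m‖) := by ring
        _ ≤ _ := by gcongr; exact hM' m
    · rw [norm_zero]
      have : 0 ≤ M := le_trans (by positivity) (hM' 0)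
      positivity

/-- Taylor coefficients of products. -/
theorem iteratedDeriv_mul_div_factorial {f g : ℂ → ℂ} (hf : AnalyticAt ℂ f 0)
    (hg : AnalyticAt ℂ g 0) (n : ℕ) :
    iteratedDeriv n (fun z => f z * g z) 0 / (n.factorial : ℂ) =
      ∑ i ∈ Finset.range (n + 1), iteratedDeriv i f 0 / (i.factorial : ℂ) *
        (iteratedDeriv (n - i) g 0 / ((n - i).factorial : ℂ)) := by
  have h := iteratedDeriv_mul (n := n) hf.contDiffAt hg.contDiffAt
  change iteratedDeriv n (f * g) 0 / (n.factorial : ℂ) = _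
  rw [h, Finset.sum_div]
  refine Finset.sum_congr rfl fun i hi => ?_
  have hi' : i ≤ n := Nat.lt_succ_iff.1 (Finset.mem_range.1 hi)
  rw [Nat.cast_choose ℂ hi']
  have h1 : (n.factorial : ℂ) ≠ 0 := by exact_mod_cast n.factorial_ne_zero
  have h2 : (i.factorial : ℂ) ≠ 0 := by exact_mod_cast i.factorial_ne_zero
  have h3 : ((n - i).factorial : ℂ) ≠ 0 := by exact_mod_cast (n - i).factorial_ne_zero
  field_simp

theorem summable_mul_norm_taylor_and_tsum {K : ℂ → ℂ} {R : ℝ} (hR : 1 < R)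
    (hK : DifferentiableOn ℂ K (Metric.ball 0 R)) :
    (Summable fun n : ℕ => ((n : ℝ) + 1) * ‖iteratedDeriv n K 0 / (n.factorial : ℂ)‖) ∧
      ∑' n : ℕ, iteratedDeriv n K 0 / (n.factorial : ℂ) = K 1 := by
  have hsum : ∀ z ∈ Metric.ball (0 : ℂ) R,
      HasSum (fun n : ℕ => iteratedDeriv n K 0 / (n.factorial : ℂ) * z ^ n) (K z) := by
    intro z hz
    have := Complex.hasSum_taylorSeries_on_ball hK hz
    convert! this using 2 with n
    simp only [sub_zero, smul_eq_mul]
    ring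
  constructor
  · obtain ⟨r, hr1, hr2⟩ := exists_between hR
    have h1 := (hsum r (by simpa [abs_of_pos (zero_lt_one.trans hr1)] using hr2)).summable
    obtain ⟨A, hA⟩ := h1.tendsto_atTop_zero.norm.bddAbove_range
    have h2 : Summable fun n : ℕ => ((n : ℝ) ^ 1 * (r⁻¹) ^ n + (r⁻¹) ^ n) * A := by
      have h3 : ‖r⁻¹‖ < 1 := by
        rw [norm_inv, Real.norm_of_nonneg (by linarith)]
        exact inv_lt_one_of_one_lt₀ hr1
      exact ((summable_pow_mul_geometric_of_norm_lt_one 1 h3).add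
        (summable_geometric_of_norm_lt_one h3)).mul_right A
    refine Summable.of_nonneg_of_le (fun n => by positivity) (fun n => ?_) h2
    have h3 := hA ⟨n, rfl⟩
    have hr0 : 0 < r := by linarith
    simp only [norm_mul, norm_pow, Complex.norm_real, Real.norm_of_nonneg hr0.le] at h3
    rw [← le_div_iff₀ (by positivity)] at h3
    calc _ ≤ ((n : ℝ) + 1) * (A / r ^ n) := by gcongr
      _ = _ := by rw [inv_pow]; ring
  · have := hsum 1 (by simpa using hR)
    simpa using this.tsum_eq

/-- Two-term asymptotics for the Taylor coefficients of `F z * (1 - z) ^ (-(1 + β))`, where `F` is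
holomorphic on a disc of radius larger than `1`. -/
theorem tendsto_coeff_mul_one_sub_cpow {β R : ℝ} (hβ : 0 < β) (hβ1 : β ≤ 1) (hR : 1 < R)
    {F : ℂ → ℂ} (hF : DifferentiableOn ℂ F (Metric.ball 0 R)) :
    Tendsto (fun n : ℕ => (((n : ℝ) ^ (1 - β) : ℝ) : ℂ) *
        (iteratedDeriv n (fun z => F z * (1 - z) ^ (-((1 + β : ℝ) : ℂ))) 0 / (n.factorial : ℂ)) -
          F 1 * ((Real.Gamma (1 + β))⁻¹ : ℝ) * n) atTop
      (𝓝 (((Real.Gamma (1 + β))⁻¹ : ℝ) * (F 1 * (β * (β + 1) / 2) - β * deriv F 1))) := by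
  generalize hL : (Real.Gamma (1 + β))⁻¹ = L
  set K := dslope F 1
  have h1mem : (1 : ℂ) ∈ Metric.ball (0 : ℂ) R := by simpa using hR
  have hK : DifferentiableOn ℂ K (Metric.ball 0 R) :=
    (Complex.differentiableOn_dslope (Metric.isOpen_ball.mem_nhds h1mem)).2 hF
  have hK0 : AnalyticAt ℂ K 0 :=
    hK.analyticAt (Metric.isOpen_ball.mem_nhds (by simpa using zero_lt_one.trans hR))
  have hprod : AnalyticAt ℂ (fun z => K z * (1 - z) ^ (-(β : ℂ))) 0 :=
    hK0.mul (analyticAt_one_sub_cpow _)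
  have hconst : AnalyticAt ℂ (fun z => F 1 * (1 - z) ^ (-((1 + β : ℝ) : ℂ))) 0 :=
    analyticAt_const.mul (analyticAt_one_sub_cpow _)
  have heq : (fun z => F z * (1 - z) ^ (-((1 + β : ℝ) : ℂ))) =ᶠ[𝓝 0]
      (fun z => F 1 * (1 - z) ^ (-((1 + β : ℝ) : ℂ))) -
        fun z => K z * (1 - z) ^ (-(β : ℂ)) := by
    filter_upwards [isOpen_ne.mem_nhds (zero_ne_one' ℂ)] with z hz
    have hz' : 1 - z ≠ 0 := sub_ne_zero.2 (Ne.symm hz)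
    have h1 : (1 - z) ^ (-(β : ℂ)) = (1 - z) * (1 - z) ^ (-((1 + β : ℝ) : ℂ)) := by
      have h : -(β : ℂ) = 1 + -((1 + β : ℝ) : ℂ) := by push_cast; ring
      rw [h, Complex.cpow_add _ _ hz', Complex.cpow_one]
    have h2 : F z = F 1 + (z - 1) * K z := by
      have := sub_smul_dslope F 1 z
      rw [smul_eq_mul] at this
      rw [this]; ring
    simp only [Pi.sub_apply]
    rw [h1, h2]; ring
  have hcoef : ∀ n : ℕ,
      iteratedDeriv n (fun z => F z * (1 - z) ^ (-((1 + β : ℝ) : ℂ))) 0 / (n.factorial : ℂ) =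
        F 1 * risingCoeff (1 + β) n -
          ∑ i ∈ Finset.range (n + 1), iteratedDeriv i K 0 / (i.factorial : ℂ) *
            (risingCoeff β (n - i) : ℂ) := by
    intro n
    rw [heq.iteratedDeriv_eq, iteratedDeriv_sub hconst.contDiffAt hprod.contDiffAt, sub_div,
      iteratedDeriv_const_mul_field, mul_div_assoc, iteratedDeriv_one_sub_cpow_neg]
    congr 1
    refine (iteratedDeriv_mul_div_factorial hK0 (analyticAt_one_sub_cpow _) n).trans ?_
    simp only [iteratedDeriv_one_sub_cpow_neg]
  obtain ⟨hsum, htsum⟩ := summable_mul_norm_taylor_and_tsum hR hK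
  have hconv := tendsto_weighted_convolution (s := 1 - β) (by linarith)
    (k := fun n => iteratedDeriv n K 0 / (n.factorial : ℂ))
    (e := fun n => (risingCoeff β n : ℂ)) (L := ((β * L : ℝ) : ℂ))
    (by exact_mod_cast (Complex.continuous_ofReal.tendsto _).comp
          (hL ▸ tendsto_risingCoeff_lower hβ))
    (by
      refine Summable.of_nonneg_of_le (fun n => by positivity) (fun n => ?_) hsum
      gcongr
      refine (Real.rpow_le_rpow_of_exponent_le (by simp) (by linarith)).trans_eq (Real.rpow_one _))
  rw [htsum] at hconv
  have hratio : Tendsto (fun n : ℕ => ((((n : ℝ) / (n + 1)) ^ (1 - β) : ℝ) : ℂ)) atTop (𝓝 1) := by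
    have := (tendsto_natCast_div_add_atTop (1 : ℝ)).rpow_const (p := 1 - β) (by simp)
    rw [Real.one_rpow] at this
    exact_mod_cast (Complex.continuous_ofReal.tendsto _).comp this
  have hsecond := ((Complex.continuous_ofReal.tendsto _).comp
    (hL ▸ tendsto_risingCoeff_second_order hβ)).const_mul (F 1)
  have hfinal := hsecond.sub (hratio.mul hconv)
  have hK1 : K 1 = deriv F 1 := dslope_same F 1
  rw [hK1] at hfinal
  convert hfinal.congr' ?_ using 2
  · push_cast
    ring
  · filter_upwards [eventually_gt_atTop 0] with n hn
    have hn' : (0 : ℝ) < n := by exact_mod_cast hn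
    have h1 : ((((n : ℝ) / (n + 1)) ^ (1 - β) : ℝ) : ℂ) * ((((n : ℝ) + 1) ^ (1 - β) : ℝ) : ℂ) =
        (((n : ℝ) ^ (1 - β) : ℝ) : ℂ) := by
      rw [← Complex.ofReal_mul, ← Real.mul_rpow (by positivity) (by positivity),
        div_mul_cancel₀ _ (by positivity)]
    have h2 : (n : ℝ) * (risingCoeff (1 + β) n / (n : ℝ) ^ β - L) =
        (n : ℝ) ^ (1 - β) * risingCoeff (1 + β) n - L * n := by
      rw [Real.rpow_sub hn', Real.rpow_one]
      ring
    simp only [Function.comp]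
    rw [hcoef, ← mul_assoc, h1, h2]
    push_cast
    ring

section PartialFractions

variable {k ι : Type*} [Field k] [DecidableEq ι] {s : Finset ι} {v : ι → k} {p : k[X]} {a : k}

theorem eval_derivative_eq_of_eq_mul_nodal (hp : p = C a * Lagrange.nodal s v) {i : ι}
    (hi : i ∈ s) :
    p.derivative.eval (v i) = a * (Lagrange.nodal (s.erase i) v).eval (v i) := by
  rw [hp, derivative_C_mul, eval_C_mul, Lagrange.eval_nodal_derivative_eval_node_eq hi]

theorem eval_nodal_erase_ne_zero (hv : Set.InjOn v s) {i : ι} (hi : i ∈ s) :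
    (Lagrange.nodal (s.erase i) v).eval (v i) ≠ 0 :=
  Lagrange.eval_nodal_not_at_node fun _ hj h =>
    (Finset.mem_erase.1 hj).1 (hv (Finset.mem_of_mem_erase hj) hi h.symm)

theorem eval_nodal_erase_erase (hv : Set.InjOn v s) {i j : ι} (hi : i ∈ s) (hj : j ∈ s.erase i) :
    (Lagrange.nodal ((s.erase i).erase j) v).eval (v i) =
      (Lagrange.nodal (s.erase i) v).eval (v i) / (v i - v j) := by
  have hne : v i - v j ≠ 0 := sub_ne_zero.2 fun h =>
    (Finset.mem_erase.1 hj).1 (hv (Finset.mem_of_mem_erase hj) hi h.symm)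
  rw [Lagrange.nodal_eq_mul_nodal_erase hj (s := s.erase i)]
  simp only [eval_mul, eval_sub, eval_X, eval_C]
  field_simp

theorem eval_derivative_nodal_erase (hv : Set.InjOn v s) {i : ι} (hi : i ∈ s) :
    (Lagrange.nodal (s.erase i) v).derivative.eval (v i) =
      (Lagrange.nodal (s.erase i) v).eval (v i) * ∑ j ∈ s.erase i, 1 / (v i - v j) := by
  rw [Lagrange.derivative_nodal, eval_finsetSum, Finset.mul_sum]
  refine Finset.sum_congr rfl fun j hj => ?_
  rw [eval_nodal_erase_erase hv hi hj, mul_one_div]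

theorem sum_one_div_node_sub (hp : p = C a * Lagrange.nodal s v)
    (hv : Set.InjOn v s) {i : ι} (hi : i ∈ s) :
    p.derivative.derivative.eval (v i) =
      2 * p.derivative.eval (v i) * ∑ j ∈ s.erase i, 1 / (v i - v j) := by
  rw [eval_derivative_eq_of_eq_mul_nodal hp hi, hp, Lagrange.nodal_eq_mul_nodal_erase hi]
  simp only [derivative_mul, derivative_C, derivative_add, derivative_sub, derivative_X,
    derivative_zero, eval_mul, eval_add, eval_sub, eval_X, eval_C, eval_zero, eval_one,
    derivative_one, eval_derivative_nodal_erase hv hi]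
  ring

theorem sum_one_div_derivative_mul_node (hp : p = C a * Lagrange.nodal s v) (ha : a ≠ 0)
    (hv : Set.InjOn v s) (hs : s.Nonempty) (h0 : ∀ i ∈ s, v i ≠ 0) :
    p.eval 0 * ∑ i ∈ s, 1 / (p.derivative.eval (v i) * v i) = -1 := by
  have h := Lagrange.eval_interpolate_not_at_node (s := s) (v := v) (x := 0) 1
    fun i hi => (h0 i hi).symm
  rw [Lagrange.interpolate_one hv hs, eval_one] at h
  have h1 : ∑ i ∈ s, 1 / (p.derivative.eval (v i) * v i) =
      -(a⁻¹ * ∑ i ∈ s, Lagrange.nodalWeight s v i * (0 - v i)⁻¹ * (1 : ι → k) i) := by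
    rw [Finset.mul_sum, ← Finset.sum_neg_distrib]
    refine Finset.sum_congr rfl fun i hi => ?_
    rw [eval_derivative_eq_of_eq_mul_nodal hp hi, Lagrange.nodalWeight_eq_eval_nodal_erase_inv]
    have := h0 i hi
    have := eval_nodal_erase_ne_zero hv hi
    simp only [zero_sub, Pi.one_apply, inv_neg]
    field_simp
  rw [h1, hp, eval_C_mul, mul_neg, mul_mul_mul_comm, mul_inv_cancel₀ ha, one_mul, ← h]

theorem sum_one_div_derivative_mul_node_sub (hp : p = C a * Lagrange.nodal s v) (ha : a ≠ 0)
    (hv : Set.InjOn v s) {i : ι} (hi : i ∈ s) :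
    p.derivative.eval (v i) * ∑ j ∈ s.erase i, 1 / (p.derivative.eval (v j) * (v i - v j)) =
      -∑ j ∈ s.erase i, 1 / (v i - v j) := by
  have h := congrArg (fun f : k[X] => f.derivative.eval (v i)) (Lagrange.sum_basis hv ⟨i, hi⟩)
  have hbasis : ∀ j ∈ s, Lagrange.basis s v j =
      C (Lagrange.nodalWeight s v j) * Lagrange.nodal (s.erase j) v := fun j hj => by
    rw [Lagrange.basis_eq_prod_sub_inv_mul_nodal_div hj, Lagrange.nodal_erase_eq_nodal_div hj]
  simp only [Finset.sum_congr rfl hbasis, derivative_sum, derivative_one, eval_zero,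
    eval_finsetSum, derivative_C_mul, eval_C_mul] at h
  rw [← Finset.add_sum_erase _ _ hi, eval_derivative_nodal_erase hv hi,
    Lagrange.nodalWeight_eq_eval_nodal_erase_inv,
    inv_mul_cancel_left₀ (eval_nodal_erase_ne_zero hv hi)] at h
  rw [eq_neg_iff_add_eq_zero, add_comm, ← h, Finset.mul_sum]
  congr 1
  refine Finset.sum_congr rfl fun j hj => ?_
  have hj' := Finset.mem_of_mem_erase hj
  have hij : i ∈ s.erase j := Finset.mem_erase.2 ⟨(Finset.mem_erase.1 hj).1.symm, hi⟩
  have hne := eval_nodal_erase_ne_zero hv hj'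
  have hsub : v i - v j ≠ 0 := sub_ne_zero.2 fun h =>
    (Finset.mem_erase.1 hj).1 (hv hj' hi h.symm)
  rw [Lagrange.eval_nodal_derivative_eval_node_eq hij, Finset.erase_right_comm,
    eval_nodal_erase_erase hv hi hj, Lagrange.nodalWeight_eq_eval_nodal_erase_inv,
    eval_derivative_eq_of_eq_mul_nodal hp hi, eval_derivative_eq_of_eq_mul_nodal hp hj']
  field_simp

/-- The residue computation behind the second-order coefficient. -/
theorem sum_residue_identity (hp : p = C a * Lagrange.nodal s v) (ha : a ≠ 0)
    (hv : Set.InjOn v s) {i : ι} (hi : i ∈ s) (hvi : v i = 1) (h0 : ∀ i ∈ s, v i ≠ 0)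
    (h2 : (2 : k) ≠ 0) :
    1 + ∑ j ∈ s.erase i, (1 - p.eval 0 / (p.derivative.eval (v j) * v j)) / (v j - 1) =
      -(p.derivative.derivative.eval 1 / (2 * p.derivative.eval 1)) -
        p.eval 0 * p.derivative.derivative.eval 1 / (2 * p.derivative.eval 1 ^ 2) -
          p.eval 0 / p.derivative.eval 1 := by
  have hA := sum_one_div_node_sub hp hv hi
  have hB := sum_one_div_derivative_mul_node hp ha hv ⟨i, hi⟩ h0
  have hC := sum_one_div_derivative_mul_node_sub hp ha hv hi
  rw [← Finset.add_sum_erase _ _ hi] at hB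
  have hd : p.derivative.eval (v i) ≠ 0 := by
    rw [eval_derivative_eq_of_eq_mul_nodal hp hi]
    exact mul_ne_zero ha (eval_nodal_erase_ne_zero hv hi)
  rw [hvi] at hA hB hC hd
  have hsplit : ∑ j ∈ s.erase i, (1 - p.eval 0 / (p.derivative.eval (v j) * v j)) / (v j - 1) =
      -∑ j ∈ s.erase i, 1 / (1 - v j) + p.eval 0 *
        ∑ j ∈ s.erase i, 1 / (p.derivative.eval (v j) * (1 - v j)) +
          p.eval 0 * ∑ j ∈ s.erase i, 1 / (p.derivative.eval (v j) * v j) := by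
    rw [Finset.mul_sum, Finset.mul_sum, ← Finset.sum_neg_distrib, ← Finset.sum_add_distrib,
      ← Finset.sum_add_distrib]
    refine Finset.sum_congr rfl fun j hj => ?_
    have hj' := Finset.mem_of_mem_erase hj
    have hsub : 1 - v j ≠ 0 := sub_ne_zero.2 fun h =>
      (Finset.mem_erase.1 hj).1 (hv hj' hi (h.symm.trans hvi.symm))
    have hsub' : v j - 1 ≠ 0 := by rwa [← neg_ne_zero, neg_sub]
    have hdj : p.derivative.eval (v j) ≠ 0 := by
      rw [eval_derivative_eq_of_eq_mul_nodal hp hj']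
      exact mul_ne_zero ha (eval_nodal_erase_ne_zero hv hj')
    have hvj := h0 j hj'
    field_simp
    ring
  rw [hsplit]
  generalize ∑ j ∈ s.erase i, 1 / (1 - v j) = A at *
  generalize ∑ j ∈ s.erase i, 1 / (p.derivative.eval (v j) * v j) = B at *
  generalize ∑ j ∈ s.erase i, 1 / (p.derivative.eval (v j) * (1 - v j)) = D at *
  have hD : D = -A / p.derivative.eval 1 := by rw [← hC]; field_simp
  have hB' : p.eval 0 * B = -1 - p.eval 0 / p.derivative.eval 1 := by
    rw [← hB]; field_simp; ring
  rw [hB', hD, hA]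
  field_simp
  ring

end PartialFractions

theorem eq_C_leadingCoeff_mul_nodal {k ι : Type*} [Field k] {s : Finset ι} {v : ι → k} {p : k[X]}
    (hv : Set.InjOn v s) (hs : s.Nonempty) (hdeg : p.natDegree = s.card)
    (hroot : ∀ i ∈ s, p.eval (v i) = 0) :
    p = C p.leadingCoeff * Lagrange.nodal s v := by
  have hp : p ≠ 0 := by
    rintro rfl
    simp [eq_comm, hs.ne_empty] at hdeg
  have hlc : p.leadingCoeff ≠ 0 := leadingCoeff_ne_zero.2 hp
  have hd : p.degree = (C p.leadingCoeff * Lagrange.nodal s v).degree := by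
    rw [degree_C_mul hlc, Lagrange.degree_nodal, degree_eq_natDegree hp, hdeg]
  refine eq_of_degree_sub_lt_of_eval_index_eq s hv ?_ fun i hi => ?_
  · rw [← hdeg, ← degree_eq_natDegree hp]
    refine degree_sub_lt_left hd hp ?_
    rw [leadingCoeff_mul, leadingCoeff_C,
      (Lagrange.nodal_monic : (Lagrange.nodal s v).Monic), mul_one]
  · rw [hroot i hi, eval_C_mul, Lagrange.eval_nodal_at_node hi, mul_zero]

theorem eval_one_pos_of_coeff_nonneg {q : ℝ[X]} (hq : q ≠ 0) (hcoeff : ∀ i, 0 ≤ q.coeff i) :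
    0 < q.eval 1 := by
  rw [eval_eq_sum, Polynomial.sum]
  refine Finset.sum_pos (fun i hi => ?_) (support_nonempty.2 hq)
  simpa using (hcoeff i).lt_of_ne' (mem_support_iff.1 hi)

theorem eval_one_le_eval_derivative_one {q : ℝ[X]} (hcoeff : ∀ i, 0 ≤ q.coeff i)
    (hq0 : q.coeff 0 = 0) : q.eval 1 ≤ q.derivative.eval 1 := by
  rw [derivative_eval, eval_eq_sum, Polynomial.sum, Polynomial.sum]
  refine Finset.sum_le_sum fun i hi => ?_
  have hi0 : i ≠ 0 := by
    rintro rfl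
    exact mem_support_iff.1 hi hq0
  have : (1 : ℝ) ≤ i := by exact_mod_cast Nat.one_le_iff_ne_zero.2 hi0
  simpa using le_mul_of_one_le_right (hcoeff i) this

theorem one_sub_div_mem_slitPlane {z w : ℂ} (h : ‖z‖ < ‖w‖) : 1 - z / w ∈ Complex.slitPlane := by
  rw [sub_eq_add_neg]
  refine Complex.mem_slitPlane_of_norm_lt_one ?_
  rw [norm_neg, norm_div]
  exact (div_lt_one ((norm_nonneg z).trans_lt h)).2 h

theorem hasDerivAt_prod_one_sub_div_cpow {ι : Type*} (s : Finset ι) {b a : ι → ℂ}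
    (hb : ∀ j ∈ s, 1 < ‖b j‖) :
    HasDerivAt (fun z : ℂ => ∏ j ∈ s, (1 - z / b j) ^ a j)
      ((∏ j ∈ s, (1 - 1 / b j) ^ a j) * -∑ j ∈ s, a j / (b j - 1)) 1 := by
  classical
  induction s using Finset.induction_on with
  | empty => simpa using hasDerivAt_const (1 : ℂ) (1 : ℂ)
  | insert i s hi ih =>
    have hbi := hb i (Finset.mem_insert_self i s)
    have hslit : 1 - 1 / b i ∈ Complex.slitPlane := one_sub_div_mem_slitPlane (by simpa using hbi)
    have hne : 1 - 1 / b i ≠ 0 := Complex.slitPlane_ne_zero hslit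
    have hb0 : b i ≠ 0 := norm_pos_iff.1 (zero_lt_one.trans hbi)
    have hb1 : b i - 1 ≠ 0 := fun h => by
      rw [sub_eq_zero.1 h, norm_one] at hbi
      exact lt_irrefl _ hbi
    have h1 : HasDerivAt (fun z : ℂ => (1 - z / b i) ^ a i)
        ((1 - 1 / b i) ^ a i * -(a i / (b i - 1))) 1 := by
      convert! (((hasDerivAt_id (1 : ℂ)).div_const (b i)).const_sub 1).cpow_const
        (c := a i) hslit using 1
      simp only [id]
      rw [Complex.cpow_sub _ _ hne, Complex.cpow_one]
      have : 1 - 1 / b i = (b i - 1) / b i := by field_simp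
      rw [this]
      field_simp
    simp only [Finset.prod_insert hi, Finset.sum_insert hi]
    convert! h1.mul (ih fun j hj => hb j (Finset.mem_insert_of_mem hj)) using 1
    ring

theorem differentiableOn_prod_one_sub_div_cpow {ι : Type*} (s : Finset ι) {b : ι → ℂ}
    (a : ι → ℂ) {R : ℝ} (hb : ∀ j ∈ s, R ≤ ‖b j‖) :
    DifferentiableOn ℂ (fun z : ℂ => ∏ j ∈ s, (1 - z / b j) ^ a j) (Metric.ball 0 R) := by
  refine DifferentiableOn.fun_finsetProd fun j hj z hz => ?_
  refine (DifferentiableAt.cpow (by fun_prop) (by fun_prop) ?_).differentiableWithinAt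
  exact one_sub_div_mem_slitPlane ((mem_ball_zero_iff.1 hz).trans_le (hb j hj))

theorem exists_one_lt_le_norm {ι : Type*} (s : Finset ι) {b : ι → ℂ}
    (hb : ∀ j ∈ s, 1 < ‖b j‖) : ∃ R : ℝ, 1 < R ∧ ∀ j ∈ s, R ≤ ‖b j‖ := by
  have h : ∀ᶠ R : ℝ in 𝓝[>] 1, ∀ j ∈ s, R ≤ ‖b j‖ := (Finset.eventually_all s).2 fun j hj =>
    mem_nhdsWithin_of_mem_nhds (Iic_mem_nhds (hb j hj))
  obtain ⟨R, hR, hR1⟩ := (h.and self_mem_nhdsWithin).exists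
  exact ⟨R, hR1, hR⟩

theorem isLittleO_of_tendsto_rpow_mul_sub {β : ℝ} {f : ℕ → ℂ} {A B : ℂ}
    (h : Tendsto (fun n : ℕ => (((n : ℝ) ^ (1 - β) : ℝ) : ℂ) * f n - A * n) atTop (𝓝 B)) :
    (fun n : ℕ => f n - A * (((n : ℝ) ^ β : ℝ) : ℂ) - B * (((n : ℝ) ^ (β - 1) : ℝ) : ℂ)) =o[atTop]
      fun n : ℕ => (n : ℝ) ^ (β - 1) := by
  have h0 : (fun n : ℕ => (((n : ℝ) ^ (1 - β) : ℝ) : ℂ) * f n - A * n - B) =o[atTop]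
      fun _ : ℕ => (1 : ℂ) := (isLittleO_one_iff ℂ).2 (by simpa using h.sub_const B)
  have h1 := (isBigO_refl (fun n : ℕ => (((n : ℝ) ^ (β - 1) : ℝ) : ℂ)) atTop).mul_isLittleO h0
  simp only [mul_one] at h1
  refine (Complex.isLittleO_ofReal_right.1 h1).congr' ?_ EventuallyEq.rfl
  filter_upwards [eventually_gt_atTop 0] with n hn
  have hn' : (0 : ℝ) < n := by exact_mod_cast hn
  have h2 : (((n : ℝ) ^ (β - 1) : ℝ) : ℂ) * (((n : ℝ) ^ (1 - β) : ℝ) : ℂ) = 1 := by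
    rw [← Complex.ofReal_mul, ← Real.rpow_add hn']
    simp
  have h3 : (((n : ℝ) ^ (β - 1) : ℝ) : ℂ) * n = (((n : ℝ) ^ β : ℝ) : ℂ) := by
    rw [← Complex.ofReal_natCast, ← Complex.ofReal_mul, ← Real.rpow_add_one hn'.ne',
      sub_add_cancel]
  rw [← h3]
  linear_combination f n * h2

/-- Corollary 2, two-term asymptotics: with `q`, `b` as in Corollary 1 and
moreover `b_1 = 1` (root of index `j0`) and `|b_j| > 1` for the remaining roots, setting
`β = q(1)/q'(1)`, `C = Γ(1 + β)⁻¹·∏_{j ≠ j0}(1 − 1/b_j)^(−1 − q(1)/(q'(b_j)b_j))` and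
`D = q(1)(q'(1) − q(1))(q''(1) + q'(1))/(2 q'(1)³)`, the Taylor coefficients of `Φ`
satisfy `φ_n = C n^β + C D n^{β−1} + o(n^{β−1})` as `n → ∞`. -/
theorem phiProd_coeff_two_term_asymptotics (N : ℕ) (hN : 1 ≤ N) (q : Polynomial ℝ)
    (hdeg : q.natDegree = N) (hcoeff : ∀ i, 0 ≤ q.coeff i) (hq0 : q.coeff 0 = 0)
    (b : Fin N → ℂ) (hb : Function.Injective b)
    (hroot : ∀ j, Polynomial.aeval (b j) q = ((q.eval 1 : ℝ) : ℂ))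
    (j0 : Fin N) (hb1 : b j0 = 1) (hbig : ∀ j, j ≠ j0 → 1 < ‖b j‖) :
    (fun n : ℕ =>
        iteratedDeriv n (PhiProd N q b) 0 / (n.factorial : ℂ) -
          ((Complex.Gamma (1 + ((q.eval 1 / q.derivative.eval 1 : ℝ) : ℂ)))⁻¹ *
              ∏ j ∈ Finset.univ.erase j0, (1 - 1 / b j) ^
                (-1 - ((q.eval 1 : ℝ) : ℂ) /
                  (Polynomial.aeval (b j) q.derivative * b j))) *
            (((n : ℝ) ^ (q.eval 1 / q.derivative.eval 1) : ℝ) : ℂ) -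
          ((Complex.Gamma (1 + ((q.eval 1 / q.derivative.eval 1 : ℝ) : ℂ)))⁻¹ *
              ∏ j ∈ Finset.univ.erase j0, (1 - 1 / b j) ^
                (-1 - ((q.eval 1 : ℝ) : ℂ) /
                  (Polynomial.aeval (b j) q.derivative * b j))) *
            ((q.eval 1 * (q.derivative.eval 1 - q.eval 1) *
                (q.derivative.derivative.eval 1 + q.derivative.eval 1) /
                (2 * q.derivative.eval 1 ^ 3) : ℝ) : ℂ) *
            (((n : ℝ) ^ (q.eval 1 / q.derivative.eval 1 - 1) : ℝ) : ℂ)) =o[atTop]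
      (fun n : ℕ => (n : ℝ) ^ (q.eval 1 / q.derivative.eval 1 - 1)) := by
  have hq : q ≠ 0 := by
    rintro rfl
    simp at hdeg
    omega
  have hq1 := eval_one_pos_of_coeff_nonneg hq hcoeff
  have hle := eval_one_le_eval_derivative_one hcoeff hq0
  have hd1 : 0 < q.derivative.eval 1 := hq1.trans_le hle
  obtain ⟨p, hp⟩ : ∃ p : ℂ[X], p = q.map (algebraMap ℝ ℂ) - C ((q.eval 1 : ℝ) : ℂ) := ⟨_, rfl⟩
  have hder : p.derivative = q.derivative.map (algebraMap ℝ ℂ) := by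
    rw [hp, derivative_sub, derivative_C, sub_zero, derivative_map]
  have hderb : ∀ j, p.derivative.eval (b j) = aeval (b j) q.derivative := fun j => by
    rw [hder, eval_map_algebraMap]
  have hder1 : p.derivative.eval 1 = ((q.derivative.eval 1 : ℝ) : ℂ) := by
    rw [hder, eval_one_map, Complex.coe_algebraMap]
  have hder2 : p.derivative.derivative.eval 1 = ((q.derivative.derivative.eval 1 : ℝ) : ℂ) := by
    rw [hder, derivative_map, eval_one_map, Complex.coe_algebraMap]
  have hp0 : p.eval 0 = -((q.eval 1 : ℝ) : ℂ) := by
    rw [hp, eval_sub, eval_C, ← coeff_zero_eq_eval_zero, coeff_map, hq0, map_zero, zero_sub]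
  have hpdeg : p.natDegree = (Finset.univ : Finset (Fin N)).card := by
    rw [hp, natDegree_sub_C, natDegree_map, hdeg, Finset.card_univ, Fintype.card_fin]
  have hpne : p ≠ 0 := by
    rintro rfl
    simp at hpdeg
    omega
  have hinj : Set.InjOn b (Finset.univ : Finset (Fin N)) := hb.injOn
  have hnodal := eq_C_leadingCoeff_mul_nodal hinj ⟨j0, Finset.mem_univ j0⟩ hpdeg fun j _ => by
    rw [hp, eval_sub, eval_map_algebraMap, hroot, eval_C, sub_self]
  have hbig' : ∀ j ∈ Finset.univ.erase j0, 1 < ‖b j‖ :=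
    fun j hj => hbig j (Finset.mem_erase.1 hj).1
  have hb0 : ∀ j ∈ Finset.univ, b j ≠ 0 := fun j _ h => by
    rcases eq_or_ne j j0 with rfl | hj
    · exact one_ne_zero (hb1.symm.trans h)
    · have := hbig j hj
      rw [h, norm_zero] at this
      linarith
  have hres := sum_residue_identity hnodal (leadingCoeff_ne_zero.2 hpne) hinj (Finset.mem_univ j0)
    hb1 hb0 two_ne_zero
  rw [hp0, hder1, hder2] at hres
  have hβ : 0 < q.eval 1 / q.derivative.eval 1 := div_pos hq1 hd1
  have hβ1 : q.eval 1 / q.derivative.eval 1 ≤ 1 := (div_le_one hd1).2 hle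
  obtain ⟨β, hβdef⟩ : ∃ β : ℝ, β = q.eval 1 / q.derivative.eval 1 := ⟨_, rfl⟩
  obtain ⟨a, ha⟩ : ∃ a : Fin N → ℂ, a = fun j =>
    -1 - ((q.eval 1 : ℝ) : ℂ) / (aeval (b j) q.derivative * b j) := ⟨_, rfl⟩
  obtain ⟨R, hR, hbR⟩ := exists_one_lt_le_norm _ hbig'
  have hF : DifferentiableOn ℂ (fun z => z * ∏ j ∈ Finset.univ.erase j0, (1 - z / b j) ^ a j)
      (Metric.ball 0 R) :=
    differentiableOn_id.mul (differentiableOn_prod_one_sub_div_cpow _ a hbR)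
  have hF' : deriv (fun z => z * ∏ j ∈ Finset.univ.erase j0, (1 - z / b j) ^ a j) 1 =
      (∏ j ∈ Finset.univ.erase j0, (1 - 1 / b j) ^ a j) *
        (1 - ∑ j ∈ Finset.univ.erase j0, a j / (b j - 1)) := by
    refine ((hasDerivAt_id (1 : ℂ)).mul
      (hasDerivAt_prod_one_sub_div_cpow _ (a := a) hbig')).deriv.trans ?_
    simp only [id]
    ring
  have hPhi : PhiProd N q b = fun z =>
      (z * ∏ j ∈ Finset.univ.erase j0, (1 - z / b j) ^ a j) * (1 - z) ^ (-((1 + β : ℝ) : ℂ)) := by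
    funext z
    have haj0 : a j0 = -((1 + β : ℝ) : ℂ) := by
      rw [ha]
      simp only
      rw [← hderb, hb1, hder1, mul_one, hβdef]
      push_cast
      ring
    rw [← haj0, mul_assoc, mul_comm (∏ j ∈ _, _)]
    have := Finset.mul_prod_erase Finset.univ (fun j => (1 - z / b j) ^ a j) (Finset.mem_univ j0)
    simp only [hb1, div_one] at this
    rw [this, PhiProd, ha]
  have hmain := tendsto_coeff_mul_one_sub_cpow hβ hβ1 hR hF
  rw [← hβdef] at hmain ⊢
  rw [← hPhi] at hmain
  have hΓ : Complex.Gamma (1 + (β : ℂ)) = (Real.Gamma (1 + β) : ℂ) := by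
    rw [← Complex.Gamma_ofReal]
    push_cast
    rfl
  have hsum : ∑ j ∈ Finset.univ.erase j0, a j / (b j - 1) = -∑ j ∈ Finset.univ.erase j0,
      (1 - -((q.eval 1 : ℝ) : ℂ) / (p.derivative.eval (b j) * b j)) / (b j - 1) := by
    rw [← Finset.sum_neg_distrib]
    refine Finset.sum_congr rfl fun j _ => ?_
    rw [ha, hderb]
    ring
  have hd1' : ((q.derivative.eval 1 : ℝ) : ℂ) ≠ 0 := by exact_mod_cast hd1.ne'
  rw [hΓ]
  have hprod : ∏ j ∈ Finset.univ.erase j0, (1 - 1 / b j) ^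
      (-1 - ((q.eval 1 : ℝ) : ℂ) / (aeval (b j) q.derivative * b j)) =
        ∏ j ∈ Finset.univ.erase j0, (1 - 1 / b j) ^ a j := by rw [ha]
  rw [hprod]
  have hlim : (((Real.Gamma (1 + β))⁻¹ : ℝ) : ℂ) *
      ((1 * ∏ j ∈ Finset.univ.erase j0, (1 - 1 / b j) ^ a j) * (β * (β + 1) / 2) -
        β * deriv (fun z => z * ∏ j ∈ Finset.univ.erase j0, (1 - z / b j) ^ a j) 1) =
      ((Real.Gamma (1 + β) : ℂ)⁻¹ * ∏ j ∈ Finset.univ.erase j0, (1 - 1 / b j) ^ a j) *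
        ((q.eval 1 * (q.derivative.eval 1 - q.eval 1) *
          (q.derivative.derivative.eval 1 + q.derivative.eval 1) /
            (2 * q.derivative.eval 1 ^ 3) : ℝ) : ℂ) := by
    rw [hF', hsum, sub_neg_eq_add]
    rw [hres, hβdef]
    push_cast
    field_simp
    ring
  rw [hlim] at hmain
  refine (isLittleO_of_tendsto_rpow_mul_sub hmain).congr_left fun n => ?_
  push_cast
  ring
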